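/- Let φ be a non-wandering flow on a generalized Peano continuum M. If the cardinality of the set CMin of compact minimal sets is strictly less than the cardinality of the continuum, then either (1) HS = ∅, i.e., the Lyapunov unstable compact minimal sets are dense in CMin with respect to the Hausdorff metric, or (2) M is compact and the flow is minimal (every orbit is dense in M). -/

import Mathlib

open Set Filter Topology Metric TopologicalSpace

variable {M : Type*} [MetricSpace M]

/-- A set is invariant under the flow `φ`. -/
def IsFlowInvariant (φ : ℝ → M → M) (K : Set M) : Prop :=
  ∀ x ∈ K, ∀ t : ℝ, φ t x ∈ K

/-- A set is positively invariant under the flow `φ`. -/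
def IsPosInvariant (φ : ℝ → M → M) (K : Set M) : Prop :=
  ∀ x ∈ K, ∀ t : ℝ, 0 ≤ t → φ t x ∈ K

/-- A compact minimal set: nonempty, compact, invariant, with no nonempty proper
closed invariant subset. -/
def IsCompactMinimalSet (φ : ℝ → M → M) (K : Set M) : Prop :=
  K.Nonempty ∧ IsCompact K ∧ IsFlowInvariant φ K ∧
    ∀ K' ⊆ K, K'.Nonempty → IsClosed K' → IsFlowInvariant φ K' → K' = K

/-- Lyapunov stability: every neighborhood of `K` contains a positively invariant
neighborhood of `K`. -/
def IsLyapunovStable (φ : ℝ → M → M) (K : Set M) : Prop :=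
  ∀ U ∈ 𝓝ˢ K, ∃ V ∈ 𝓝ˢ K, V ⊆ U ∧ IsPosInvariant φ V

/-- The ω-limit set of a point. -/
def omegaLimitSet (φ : ℝ → M → M) (x : M) : Set M :=
  ⋂ T ∈ Ici (0 : ℝ), closure ((fun t => φ t x) '' Ici T)

/-- The α-limit set of a point. -/
def alphaLimitSet (φ : ℝ → M → M) (x : M) : Set M :=
  ⋂ T ∈ Iic (0 : ℝ), closure ((fun t => φ t x) '' Iic T)

/-- A compact minimal set is hyper-stable if some neighborhood of it in `M` meets no
Lyapunov unstable compact minimal set. -/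
def IsHyperStable (φ : ℝ → M → M) (Λ : Set M) : Prop :=
  IsCompactMinimalSet φ Λ ∧ ∃ W ∈ 𝓝ˢ Λ, ∀ Γ : Set M,
    IsCompactMinimalSet φ Γ → ¬ IsLyapunovStable φ Γ → Γ ∩ W = ∅

/-- An attractor: a Lyapunov stable nonempty compact invariant set whose basin of
attraction is a neighborhood of it. -/
def IsAttractorSet (φ : ℝ → M → M) (Δ : Set M) : Prop :=
  Δ.Nonempty ∧ IsCompact Δ ∧ IsFlowInvariant φ Δ ∧ IsLyapunovStable φ Δ ∧
    {x : M | (omegaLimitSet φ x).Nonempty ∧ omegaLimitSet φ x ⊆ Δ} ∈ 𝓝ˢ Δ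

/-- The flow is non-wandering. -/
def IsNonWanderingFlow (φ : ℝ → M → M) : Prop :=
  ∀ x : M, ∀ U ∈ 𝓝 x, ∀ T > (0 : ℝ), ∃ t ≥ T, ((fun y => φ t y) '' U ∩ U).Nonempty

/-- The set of hyper-stable compact minimal sets, as a subset of the space of nonempty
compact subsets of `M` (with the Hausdorff metric). -/
def HSset (φ : ℝ → M → M) : Set (NonemptyCompacts M) :=
  {Γ | IsHyperStable φ (Γ : Set M)}

/-- The set of all compact minimal sets, as a subset of the space of nonempty compact
subsets of `M` (with the Hausdorff metric). -/
def CMinSet (φ : ℝ → M → M) : Set (NonemptyCompacts M) :=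
  {Γ | IsCompactMinimalSet φ (Γ : Set M)}

/-- `basinOf φ X` is the set of points whose ω-limit set belongs to `X`. -/
def basinOf (φ : ℝ → M → M) (X : Set (NonemptyCompacts M)) : Set M :=
  {x | ∃ Γ ∈ X, (Γ : Set M) = omegaLimitSet φ x}

/-- The union in `M` of a family of hyper-stable compact minimal sets. -/
def unionSet (φ : ℝ → M → M) (X : Set ↥(HSset φ)) : Set M :=
  {y | ∃ q ∈ X, y ∈ ((q : NonemptyCompacts M) : Set M)}

lemma continuous_flow_time {φ : ℝ → M → M} (hφcont : Continuous fun p : ℝ × M => φ p.1 p.2)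
    (t : ℝ) : Continuous (φ t) :=
  hφcont.comp (Continuous.prodMk_right t)

lemma IsFlowInvariant.closure {φ : ℝ → M → M} (hφ : ∀ t, Continuous (φ t)) {A : Set M}
    (hA : IsFlowInvariant φ A) : IsFlowInvariant φ (closure A) :=
  fun _ hx t => map_mem_closure (hφ t) hx fun y hy => hA y hy t

lemma IsPosInvariant.closure {φ : ℝ → M → M} (hφ : ∀ t, Continuous (φ t)) {A : Set M}
    (hA : IsPosInvariant φ A) : IsPosInvariant φ (closure A) :=
  fun _ hx t ht => map_mem_closure (hφ t) hx fun y hy => hA y hy t ht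

/-- The closure of the orbit of a point. -/
def orbitClosure (φ : ℝ → M → M) (x : M) : Set M :=
  closure (range fun t : ℝ => φ t x)

lemma mem_orbitClosure {φ : ℝ → M → M} (hφzero : ∀ x, φ 0 x = x) (x : M) :
    x ∈ orbitClosure φ x :=
  subset_closure ⟨0, hφzero x⟩

lemma isFlowInvariant_orbitClosure {φ : ℝ → M → M} (hφ : ∀ t, Continuous (φ t))
    (hφadd : ∀ s t : ℝ, ∀ x : M, φ s (φ t x) = φ (s + t) x) (x : M) :
    IsFlowInvariant φ (orbitClosure φ x) := by
  refine IsFlowInvariant.closure hφ ?_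
  rintro _ ⟨s, rfl⟩ t
  exact ⟨t + s, (hφadd t s x).symm⟩

lemma orbitClosure_subset_closure {φ : ℝ → M → M} {A : Set M} (hA : IsFlowInvariant φ A)
    {x : M} (hx : x ∈ A) : orbitClosure φ x ⊆ closure A :=
  closure_mono (range_subset_iff.2 fun t => hA x hx t)

lemma IsCompactMinimalSet.orbitClosure_eq {φ : ℝ → M → M} (hφ : ∀ t, Continuous (φ t))
    (hφzero : ∀ x, φ 0 x = x) (hφadd : ∀ s t : ℝ, ∀ x : M, φ s (φ t x) = φ (s + t) x)
    {K : Set M} (hK : IsCompactMinimalSet φ K) {x : M} (hx : x ∈ K) :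
    orbitClosure φ x = K := by
  obtain ⟨-, hKc, hKi, hKm⟩ := hK
  refine hKm _ ?_ ⟨x, mem_orbitClosure hφzero x⟩ isClosed_closure
    (isFlowInvariant_orbitClosure hφ hφadd x)
  simpa [hKc.isClosed.closure_eq] using orbitClosure_subset_closure hKi hx

/-- Every nonempty compact invariant set contains a compact minimal set. -/
lemma exists_isCompactMinimalSet_subset {φ : ℝ → M → M} {K : Set M} (hne : K.Nonempty)
    (hK : IsCompact K) (hinv : IsFlowInvariant φ K) :
    ∃ Γ ⊆ K, IsCompactMinimalSet φ Γ := by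
  obtain ⟨Γ, hΓK, hΓ⟩ := zorn_superset_nonempty
    {A : Set M | A.Nonempty ∧ IsCompact A ∧ IsFlowInvariant φ A} (by
      intro c hc hchain hcne
      have : Nonempty c := hcne.to_subtype
      refine ⟨⋂₀ c, ⟨?_, ?_, ?_⟩, fun s hs => sInter_subset_of_mem hs⟩
      · exact IsCompact.nonempty_sInter_of_directed_nonempty_isCompact_isClosed
          (show IsChain (· ⊇ ·) c from hchain.symm).directedOn (fun U hU => (hc hU).1)
          (fun U hU => (hc hU).2.1)
          (fun U hU => (hc hU).2.1.isClosed)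
      · obtain ⟨s, hs⟩ := hcne
        exact (hc hs).2.1.of_isClosed_subset
          (isClosed_sInter fun U hU => (hc hU).2.1.isClosed) (sInter_subset_of_mem hs)
      · exact fun x hx t U hU => (hc hU).2.2 x (hx U hU) t) K ⟨hne, hK, hinv⟩
  refine ⟨Γ, hΓK, hΓ.1.1, hΓ.1.2.1, hΓ.1.2.2, fun K' hK' hne' hcl hinv' => ?_⟩
  exact hK'.antisymm (hΓ.2 ⟨hne', hΓ.1.2.1.of_isClosed_subset hcl hK', hinv'⟩ hK')

/-- Under a non-wandering flow, a closed positively invariant set contains the full orbits of its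
interior points. -/
lemma IsPosInvariant.flow_mem_of_mem_interior {φ : ℝ → M → M} (hφ : ∀ t, Continuous (φ t))
    (hφadd : ∀ s t : ℝ, ∀ x : M, φ s (φ t x) = φ (s + t) x) (hnw : IsNonWanderingFlow φ)
    {V : Set M} (hV : IsPosInvariant φ V) (hVcl : IsClosed V) {y : M} (hy : y ∈ interior V)
    (t : ℝ) : φ t y ∈ V := by
  rcases le_or_gt 0 t with ht | ht
  · exact hV y (interior_subset hy) t ht
  by_contra hyt
  obtain ⟨s, hs, _, ⟨z, hz, rfl⟩, hz'⟩ := hnw y (interior V ∩ φ t ⁻¹' Vᶜ)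
    ((isOpen_interior.inter (hVcl.isOpen_compl.preimage (hφ t))).mem_nhds ⟨hy, hyt⟩) (-t)
    (by linarith)
  apply hz'.2
  change φ t (φ s z) ∈ V
  rw [hφadd]
  exact hV z (interior_subset hz.1) _ (by linarith)

/-- Under a non-wandering flow, a Lyapunov stable compact set has a neighborhood basis of open
invariant sets. -/
lemma IsLyapunovStable.exists_isOpen_isFlowInvariant [LocallyCompactSpace M] {φ : ℝ → M → M}
    (hφ : ∀ t, Continuous (φ t)) (hφzero : ∀ x, φ 0 x = x)
    (hφadd : ∀ s t : ℝ, ∀ x : M, φ s (φ t x) = φ (s + t) x) (hnw : IsNonWanderingFlow φ)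
    {K U : Set M} (hK : IsCompact K) (hstab : IsLyapunovStable φ K) (hU : IsOpen U)
    (hKU : K ⊆ U) :
    ∃ V, IsOpen V ∧ K ⊆ V ∧ V ⊆ U ∧ IsFlowInvariant φ V := by
  obtain ⟨N, hN, hKN, hNU⟩ := exists_compact_between hK hU hKU
  obtain ⟨P, hP, hPN, hPinv⟩ := hstab N (subset_interior_iff_mem_nhdsSet.1 hKN)
  have hclN : closure P ⊆ N := closure_minimal hPN hN.isClosed
  refine ⟨⋃ t : ℝ, φ t ⁻¹' interior (closure P),
    isOpen_iUnion fun t => isOpen_interior.preimage (hφ t), fun x hx => ?_, fun x hx => ?_,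
    fun x hx s => ?_⟩
  · refine mem_iUnion.2 ⟨0, ?_⟩
    rw [mem_preimage, hφzero]
    exact interior_mono subset_closure (subset_interior_iff_mem_nhdsSet.2 hP hx)
  · obtain ⟨t, ht⟩ := mem_iUnion.1 hx
    have := (hPinv.closure hφ).flow_mem_of_mem_interior hφ hφadd hnw isClosed_closure ht (-t)
    rw [hφadd, neg_add_cancel, hφzero] at this
    exact hNU (hclN this)
  · obtain ⟨t, ht⟩ := mem_iUnion.1 hx
    refine mem_iUnion.2 ⟨t - s, ?_⟩
    rwa [mem_preimage, hφadd, sub_add_cancel]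

/-- Under a non-wandering flow, a hyper-stable compact minimal set has an open neighborhood in
which every orbit closure is a Lyapunov stable compact minimal set. -/
lemma IsHyperStable.exists_isOpen_orbitClosure [LocallyCompactSpace M] {φ : ℝ → M → M}
    (hφ : ∀ t, Continuous (φ t)) (hφzero : ∀ x, φ 0 x = x)
    (hφadd : ∀ s t : ℝ, ∀ x : M, φ s (φ t x) = φ (s + t) x) (hnw : IsNonWanderingFlow φ)
    {Λ : Set M} (hΛ : IsHyperStable φ Λ) :
    ∃ O, IsOpen O ∧ Λ ⊆ O ∧ ∀ x ∈ O, IsCompactMinimalSet φ (orbitClosure φ x) ∧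
      IsLyapunovStable φ (orbitClosure φ x) := by
  obtain ⟨hmin, W, hW, hWst⟩ := hΛ
  have hΛW : Λ ⊆ interior W := subset_interior_iff_mem_nhdsSet.2 hW
  have stable_of_subset : ∀ Γ ⊆ W, IsCompactMinimalSet φ Γ → IsLyapunovStable φ Γ := by
    intro Γ hΓW hΓ
    by_contra hns
    have := hWst Γ hΓ hns
    rw [inter_eq_left.2 hΓW] at this
    exact hΓ.1.ne_empty this
  have hΛst := stable_of_subset Λ (hΛW.trans interior_subset) hmin
  obtain ⟨N, hN, hΛN, hNW⟩ := exists_compact_between hmin.2.1 isOpen_interior hΛW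
  obtain ⟨O, hO, hΛO, hON, hOinv⟩ := hΛst.exists_isOpen_isFlowInvariant hφ hφzero hφadd hnw
    hmin.2.1 isOpen_interior hΛN
  refine ⟨O, hO, hΛO, fun x hx => ?_⟩
  have hxN : orbitClosure φ x ⊆ N := (orbitClosure_subset_closure hOinv hx).trans
    (closure_minimal (hON.trans interior_subset) hN.isClosed)
  obtain ⟨Γ, hΓx, hΓ⟩ := exists_isCompactMinimalSet_subset ⟨x, mem_orbitClosure hφzero x⟩
    (hN.of_isClosed_subset isClosed_closure hxN) (isFlowInvariant_orbitClosure hφ hφadd x)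
  have hΓst := stable_of_subset Γ
    (hΓx.trans (hxN.trans (hNW.trans interior_subset))) hΓ
  have hxΓ : x ∈ Γ := by
    by_contra hxΓ
    obtain ⟨V, hV, hΓV, hVx, hVinv⟩ := hΓst.exists_isOpen_isFlowInvariant hφ hφzero hφadd hnw
      hΓ.2.1 (isOpen_compl_singleton (x := x)) (subset_compl_singleton_iff.2 hxΓ)
    obtain ⟨y, hy⟩ := hΓ.1
    obtain ⟨_, hz, t, rfl⟩ := mem_closure_iff.1 (hΓx hy) V hV (hΓV hy)
    have := hVinv _ hz (-t)
    rw [hφadd, neg_add_cancel, hφzero] at this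
    exact hVx this rfl
  rw [hΓ.orbitClosure_eq hφ hφzero hφadd hxΓ]
  exact ⟨hΓ, hΓst⟩

/-- Under a non-wandering flow, the infimum of a nonnegative continuous function over the orbit
closure of `x` depends continuously on `x` wherever the orbit closure is compact and Lyapunov
stable. -/
lemma continuousAt_sInf_image_orbitClosure [LocallyCompactSpace M] {φ : ℝ → M → M}
    (hφ : ∀ t, Continuous (φ t)) (hφzero : ∀ x, φ 0 x = x)
    (hφadd : ∀ s t : ℝ, ∀ x : M, φ s (φ t x) = φ (s + t) x) (hnw : IsNonWanderingFlow φ)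
    {g : M → ℝ} (hg : Continuous g) (hg0 : ∀ x, 0 ≤ g x) {y : M}
    (hy : IsCompact (orbitClosure φ y)) (hst : IsLyapunovStable φ (orbitClosure φ y)) :
    ContinuousAt (fun x => sInf (g '' orbitClosure φ x)) y := by
  have hbdd : ∀ x, BddBelow (g '' orbitClosure φ x) := fun x =>
    ⟨0, by rintro _ ⟨z, -, rfl⟩; exact hg0 z⟩
  have hne : ∀ x, (g '' orbitClosure φ x).Nonempty := fun x =>
    ⟨_, mem_image_of_mem g (mem_orbitClosure hφzero x)⟩
  refine tendsto_order.2 ⟨fun a ha => ?_, fun b hb => ?_⟩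
  · obtain ⟨c, hac, hc⟩ := exists_between ha
    obtain ⟨V, hV, hyV, hVc, hVinv⟩ := hst.exists_isOpen_isFlowInvariant hφ hφzero hφadd hnw hy
      (isOpen_Ioi.preimage hg : IsOpen (g ⁻¹' Ioi c))
      (fun z hz => hc.trans_le (csInf_le (hbdd y) (mem_image_of_mem g hz)))
    filter_upwards [hV.mem_nhds (hyV (mem_orbitClosure hφzero y))] with x hx
    refine hac.trans_le (le_csInf (hne x) ?_)
    rintro _ ⟨z, hz, rfl⟩
    have hcl : closure V ⊆ g ⁻¹' Ici c :=
      closure_minimal (fun w hw => le_of_lt (show c < g w from hVc hw)) (isClosed_Ici.preimage hg)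
    exact hcl (orbitClosure_subset_closure hVinv hx hz)
  · obtain ⟨_, ⟨z, hz, rfl⟩, hzb⟩ := exists_lt_of_csInf_lt (hne y) hb
    obtain ⟨_, hwb, t, rfl⟩ := mem_closure_iff.1 hz _ (isOpen_Iio.preimage hg) hzb
    filter_upwards [(isOpen_Iio.preimage (hg.comp (hφ t))).mem_nhds hwb] with x hx
    exact (csInf_le (hbdd x) (mem_image_of_mem g (subset_closure ⟨t, rfl⟩))).trans_lt hx

/-- Under a non-wandering flow on a connected, locally connected space with few compact minimal
sets, a hyper-stable compact minimal set is the whole space. -/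
lemma IsHyperStable.eq_univ [LocallyCompactSpace M] [ConnectedSpace M] [LocallyConnectedSpace M]
    {φ : ℝ → M → M} (hφ : ∀ t, Continuous (φ t)) (hφzero : ∀ x, φ 0 x = x)
    (hφadd : ∀ s t : ℝ, ∀ x : M, φ s (φ t x) = φ (s + t) x) (hnw : IsNonWanderingFlow φ)
    (hcard : Cardinal.mk ↥(CMinSet φ) < Cardinal.continuum)
    {Λ : Set M} (hΛ : IsHyperStable φ Λ) : Λ = univ := by
  obtain ⟨O, hO, hΛO, hOmin⟩ := hΛ.exists_isOpen_orbitClosure hφ hφzero hφadd hnw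
  have hmin := hΛ.1
  suffices hopen : IsOpen Λ from
    (IsClopen.eq_univ ⟨hmin.2.1.isClosed, hopen⟩ hmin.1)
  refine isOpen_iff_mem_nhds.2 fun x hx => ?_
  refine mem_of_superset (connectedComponentIn_mem_nhds (hO.mem_nhds (hΛO hx))) fun y hy => ?_
  by_contra hyΛ
  have hCO := connectedComponentIn_subset O x
  let F : Set M → ℝ := fun K => sInf ((fun z => infDist z Λ) '' K)
  let f : M → ℝ := fun z => F (orbitClosure φ z)
  have hf : ContinuousOn f (connectedComponentIn O x) := fun z hz =>
    (continuousAt_sInf_image_orbitClosure hφ hφzero hφadd hnw (continuous_infDist_pt Λ)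
      (fun _ => infDist_nonneg) (hOmin z (hCO hz)).1.2.1
      (hOmin z (hCO hz)).2).continuousWithinAt
  have hfx : f x ≤ 0 := by
    refine csInf_le ⟨0, ?_⟩ ⟨x, mem_orbitClosure hφzero x, infDist_zero_of_mem hx⟩
    rintro _ ⟨z, -, rfl⟩
    exact infDist_nonneg
  have hfy : 0 < f y := by
    have hmy := (hOmin y (hCO hy)).1
    obtain ⟨z, hz, hzy⟩ := (hmy.2.1.image (continuous_infDist_pt Λ)).sInf_mem (hmy.1.image _)
    change 0 < sInf _
    rw [← hzy]
    refine (hmin.2.1.isClosed.notMem_iff_infDist_pos hmin.1).1 fun hzΛ => hyΛ ?_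
    rw [← hmin.orbitClosure_eq hφ hφzero hφadd hzΛ, hmy.orbitClosure_eq hφ hφzero hφadd hz]
    exact mem_orbitClosure hφzero y
  have hsurj : ∀ v : Icc (f x) (f y), ∃ z ∈ connectedComponentIn O x, f z = v := fun v =>
    isPreconnected_connectedComponentIn.intermediate_value
      (mem_connectedComponentIn (hΛO hx)) hy hf v.2
  choose p hp hpf using hsurj
  let Ψ : Icc (f x) (f y) → CMinSet φ := fun v =>
    ⟨⟨⟨orbitClosure φ (p v), (hOmin _ (hCO (hp v))).1.2.1⟩, (hOmin _ (hCO (hp v))).1.1⟩,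
      (hOmin _ (hCO (hp v))).1⟩
  have hΨ : Function.Injective Ψ := by
    intro v w hvw
    have hset : orbitClosure φ (p v) = orbitClosure φ (p w) :=
      congrArg (fun K : CMinSet φ => ((K : NonemptyCompacts M) : Set M)) hvw
    exact Subtype.ext ((hpf v).symm.trans ((congrArg F hset).trans (hpf w)))
  have hle := Cardinal.lift_mk_le_lift_mk_of_injective hΨ
  rw [Cardinal.mk_Icc_real (hfx.trans_lt hfy), Cardinal.lift_continuum, Cardinal.lift_id'.{0}]
    at hle
  exact absurd hcard hle.not_gt

/-- A compact minimal set is a Hausdorff limit of Lyapunov unstable ones as soon as it is not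
hyper-stable. -/
lemma mem_closure_unstable_of_not_isHyperStable [LocallyCompactSpace M] {φ : ℝ → M → M}
    (hφ : ∀ t, Continuous (φ t)) (hφzero : ∀ x, φ 0 x = x)
    (hφadd : ∀ s t : ℝ, ∀ x : M, φ s (φ t x) = φ (s + t) x) (hnw : IsNonWanderingFlow φ)
    {Γ : NonemptyCompacts M} (hΓ : IsCompactMinimalSet φ (Γ : Set M))
    (hns : ¬ IsHyperStable φ (Γ : Set M)) :
    Γ ∈ closure {Δ : NonemptyCompacts M |
      IsCompactMinimalSet φ (Δ : Set M) ∧ ¬ IsLyapunovStable φ (Δ : Set M)} := by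
  by_cases hst : IsLyapunovStable φ (Γ : Set M)
  swap
  · exact subset_closure ⟨hΓ, hst⟩
  refine Metric.mem_closure_iff.2 fun ε hε => ?_
  obtain ⟨s, hsΓ, hsfin, hs⟩ := hΓ.2.1.finite_cover_balls (e := ε / 4) (by linarith)
  obtain ⟨V, hV, hΓV, hVε, hVinv⟩ := hst.exists_isOpen_isFlowInvariant hφ hφzero hφadd hnw
    hΓ.2.1 (isOpen_thickening (δ := ε / 2))
    (self_subset_thickening (half_pos hε) (Γ : Set M))
  let A : Set M := V ∩ ⋂ z ∈ s, ⋃ t : ℝ, φ t ⁻¹' ball z (ε / 4)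
  have hA : IsOpen A := hV.inter
    (hsfin.isOpen_biInter fun z _ => isOpen_iUnion fun t => isOpen_ball.preimage (hφ t))
  have hΓA : (Γ : Set M) ⊆ A := by
    refine fun x hx => ⟨hΓV hx, mem_iInter₂.2 fun z hz => ?_⟩
    have hzx : z ∈ orbitClosure φ x := by
      rw [hΓ.orbitClosure_eq hφ hφzero hφadd hx]
      exact hsΓ hz
    obtain ⟨_, hw, t, rfl⟩ :=
      mem_closure_iff.1 hzx _ isOpen_ball (mem_ball_self (by linarith : 0 < ε / 4))
    exact mem_iUnion.2 ⟨t, hw⟩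
  obtain ⟨Δ, hΔ, hΔst, x, hxΔ, hxA⟩ : ∃ Δ : Set M, IsCompactMinimalSet φ Δ ∧
      ¬ IsLyapunovStable φ Δ ∧ (Δ ∩ A).Nonempty := by
    by_contra! hcon
    exact hns ⟨hΓ, A, hA.mem_nhdsSet.2 hΓA, hcon⟩
  refine ⟨⟨⟨Δ, hΔ.2.1⟩, hΔ.1⟩, ⟨hΔ, hΔst⟩, ?_⟩
  rw [NonemptyCompacts.dist_eq]
  refine (hausdorffDist_le_of_mem_dist (r := ε / 2) (by linarith) (fun y hy => ?_)
    fun y hy => ?_).trans_lt (half_lt_self hε)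
  · obtain ⟨z, hz, hyz⟩ := mem_iUnion₂.1 (hs hy)
    obtain ⟨t, ht⟩ := mem_iUnion.1 (mem_iInter₂.1 hxA.2 z hz)
    refine ⟨φ t x, hΔ.2.2.1 x hxΔ t, ?_⟩
    have := dist_triangle_right y (φ t x) z
    have h₁ := mem_ball.1 hyz
    have h₂ := mem_ball.1 ht
    linarith
  · have hyV : y ∈ closure V := by
      refine orbitClosure_subset_closure hVinv hxA.1 ?_
      rw [hΔ.orbitClosure_eq hφ hφzero hφadd hxΔ]
      exact hy
    have hyc : y ∈ cthickening (ε / 2) (Γ : Set M) :=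
      closure_minimal (hVε.trans (thickening_subset_cthickening _ _)) isClosed_cthickening hyV
    rw [hΓ.2.1.cthickening_eq_biUnion_closedBall (by linarith)] at hyc
    obtain ⟨z, hz, hyz⟩ := mem_iUnion₂.1 hyc
    exact ⟨z, hz, hyz⟩

theorem few_minimals_nonwandering_dichotomy [LocallyCompactSpace M] [ConnectedSpace M] [LocallyConnectedSpace M]
    (φ : ℝ → M → M)
    (hφcont : Continuous fun p : ℝ × M => φ p.1 p.2)
    (hφzero : ∀ x : M, φ 0 x = x)
    (hφadd : ∀ s t : ℝ, ∀ x : M, φ s (φ t x) = φ (s + t) x)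
    (hnw : IsNonWanderingFlow φ)
    (hcard : Cardinal.mk ↥(CMinSet φ) < Cardinal.continuum) :
    (HSset φ = ∅ ∧ ∀ Γ ∈ CMinSet φ, Γ ∈ closure {Δ : NonemptyCompacts M |
        IsCompactMinimalSet φ (Δ : Set M) ∧ ¬ IsLyapunovStable φ (Δ : Set M)}) ∨
      (CompactSpace M ∧ ∀ x : M, Dense (Set.range fun t : ℝ => φ t x)) := by
  have hφ := continuous_flow_time hφcont
  rcases (HSset φ).eq_empty_or_nonempty with hHS | ⟨Λ, hΛ⟩
  · refine Or.inl ⟨hHS, fun Γ hΓ =>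
      mem_closure_unstable_of_not_isHyperStable hφ hφzero hφadd hnw hΓ fun hΓHS => ?_⟩
    exact eq_empty_iff_forall_notMem.1 hHS Γ hΓHS
  · have huniv : (Λ : Set M) = univ := IsHyperStable.eq_univ hφ hφzero hφadd hnw hcard hΛ
    refine Or.inr ⟨⟨huniv ▸ Λ.isCompact⟩, fun x => dense_iff_closure_eq.2 ?_⟩
    rw [← huniv]
    exact hΛ.1.orbitClosure_eq hφ hφzero hφadd (huniv ▸ mem_univ x)
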